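/- arXiv:2206.02589 — 4 statements merged into one kernel-verified Lean document; each statement's English description precedes it below -/
import Mathlib

section
/- Let n > 1 be an odd integer, and let ζ ∈ ℂ be a primitive n-th root of unity. For j, k = 1, ..., n-1 define ã_{jk} = 1/(1 - ζ^{j-k}) if j ≠ k, and ã_{jj} = 1/2. Then det[ã_{jk}]_{1 ≤ j,k ≤ n-1} = (-1)^{(n-1)/2} ((n-2)!!)^2 / (n · 2^{n-1}). -/
open scoped Nat

open Finset Matrix

lemma zpow_sub_ne_one {n : ℕ} {ζ : ℂ} (hζ : IsPrimitiveRoot ζ n) {j k : Fin n} (h : j ≠ k) :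
    ζ ^ ((j : ℤ) - (k : ℤ)) ≠ 1 := by
  rw [Ne, hζ.zpow_eq_one_iff_dvd]
  intro hd
  have hjk := Int.eq_zero_of_abs_lt_dvd hd (by rw [abs_lt]; omega)
  exact h (Fin.ext (by omega))

lemma zpow_sub_pow_eq_one {n : ℕ} {ζ : ℂ} (hζ : IsPrimitiveRoot ζ n) (j k : Fin n) :
    (ζ ^ ((j : ℤ) - (k : ℤ))) ^ n = 1 := by
  rw [← zpow_natCast, _root_.zpow_comm, zpow_natCast, hζ.pow_eq_one, _root_.one_zpow]

lemma zpow_geom_sum_eq_ite {n : ℕ} {ζ : ℂ} (hζ : IsPrimitiveRoot ζ n) (j k : Fin n) :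
    ∑ r : Fin n, (ζ ^ ((j : ℤ) - (k : ℤ))) ^ (r : ℕ) = if j = k then (n : ℂ) else 0 := by
  rw [Fin.sum_univ_eq_sum_range (fun r => (ζ ^ ((j : ℤ) - (k : ℤ))) ^ r) n]
  split_ifs with h
  · simp [h]
  · rw [geom_sum_eq (zpow_sub_ne_one hζ h), zpow_sub_pow_eq_one hζ, sub_self, zero_div]

lemma one_sub_mul_sum_mul_pow (x : ℂ) (n : ℕ) :
    (1 - x) * ∑ r ∈ range n, ((n : ℂ) - 2 * r) * x ^ r =
      n + n * x ^ n - 2 * x * ∑ r ∈ range n, x ^ r := by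
  have key (a : ℂ) : (1 - x) * ∑ r ∈ range n, (a - 2 * r) * x ^ r =
      a - (a - 2 * n) * x ^ n - 2 * x * ∑ r ∈ range n, x ^ r := by
    induction n with
    | zero => simp
    | succ n ih =>
      rw [sum_range_succ, sum_range_succ, mul_add, ih]
      push_cast
      ring
  rw [key]
  ring

lemma sum_fin_mul_zpow {n : ℕ} {ζ : ℂ} (hζ : IsPrimitiveRoot ζ n) (j k : Fin n) :
    ∑ r : Fin n, ((n : ℂ) - 2 * (r : ℕ)) * (ζ ^ ((j : ℤ) - (k : ℤ))) ^ (r : ℕ) =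
      2 * n * if j = k then (1 / 2 : ℂ) else 1 / (1 - ζ ^ ((j : ℤ) - (k : ℤ))) := by
  have hg := zpow_geom_sum_eq_ite hζ j k
  rw [Fin.sum_univ_eq_sum_range (fun r => (ζ ^ ((j : ℤ) - (k : ℤ))) ^ r) n] at hg
  rw [Fin.sum_univ_eq_sum_range
    (fun r => ((n : ℂ) - 2 * r) * (ζ ^ ((j : ℤ) - (k : ℤ))) ^ r) n]
  split_ifs with h
  · subst h
    have hs : (∑ r ∈ range n, (r : ℂ)) * 2 = n * (n - 1) := by
      have := congrArg (Nat.cast (R := ℂ)) (sum_range_id_mul_two n)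
      rcases n with _ | n
      · simp
      · push_cast at this ⊢
        simpa using this
    simp only [sub_self, zpow_zero, one_pow, mul_one, sum_sub_distrib, ← mul_sum, sum_const,
      card_range, nsmul_eq_mul]
    linear_combination -hs
  · have hx : 1 - ζ ^ ((j : ℤ) - (k : ℤ)) ≠ 0 := sub_ne_zero.2 (zpow_sub_ne_one hζ h).symm
    have := one_sub_mul_sum_mul_pow (ζ ^ ((j : ℤ) - (k : ℤ))) n
    rw [hg, zpow_sub_pow_eq_one hζ, if_neg h] at this
    rw [mul_one_div, eq_div_iff hx]
    linear_combination this

lemma prod_range_odd_eq (k : ℕ) :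
    ∏ r ∈ range (2 * k), ((2 * k : ℂ) - 1 - 2 * r) = (-1) ^ k * ((2 * k - 1)‼ : ℂ) ^ 2 := by
  induction k with
  | zero => simp
  | succ k ih =>
    have hd : (2 * (k + 1) - 1)‼ = (2 * k + 1) * (2 * k - 1)‼ := by
      rcases k with _ | k
      · rfl
      · exact Nat.doubleFactorial_add_two (2 * k + 1)
    rw [show 2 * (k + 1) = 2 * k + 1 + 1 by ring, prod_range_succ, prod_range_succ',
      show 2 * k + 1 + 1 - 1 = 2 * (k + 1) - 1 by omega, hd]
    have he : ∏ r ∈ range (2 * k), ((2 * (k + 1 : ℕ) : ℂ) - 1 - 2 * (r + 1 : ℕ)) =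
        ∏ r ∈ range (2 * k), ((2 * k : ℂ) - 1 - 2 * r) :=
      prod_congr rfl fun r _ => by push_cast; ring
    rw [he, ih]
    push_cast
    ring

lemma sum_range_odd_inv_eq_zero (k : ℕ) :
    ∑ r ∈ range (2 * k), ((2 * k : ℂ) - 1 - 2 * r)⁻¹ = 0 := by
  have h := sum_range_reflect (fun r : ℕ => ((2 * k : ℂ) - 1 - 2 * r)⁻¹) (2 * k)
  have h' : ∑ r ∈ range (2 * k), ((2 * k : ℂ) - 1 - 2 * (2 * k - 1 - r : ℕ))⁻¹ =
      -∑ r ∈ range (2 * k), ((2 * k : ℂ) - 1 - 2 * r)⁻¹ := by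
    rw [← sum_neg_distrib]
    refine sum_congr rfl fun r hr => ?_
    have hr' := mem_range.1 hr
    rw [← inv_neg, Nat.cast_sub (by omega), Nat.cast_sub (by omega)]
    push_cast
    congr 1
    ring
  rw [h'] at h
  linear_combination -(1 / 2 : ℂ) * h

theorem stmt_2 (n : ℕ) (hn : 1 < n) (hodd : Odd n) (ζ : ℂ)
    (hζ : IsPrimitiveRoot ζ n) :
    Matrix.det (Matrix.of fun j k : Fin (n - 1) =>
      if j = k then (1 / 2 : ℂ) else 1 / (1 - ζ ^ ((j : ℤ) - (k : ℤ)))) =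
    (-1) ^ ((n - 1) / 2) * ((n - 2)‼ : ℂ) ^ 2 / (n * 2 ^ (n - 1)) := by
  obtain ⟨k, rfl⟩ := hodd
  have hζ0 : ζ ≠ 0 := hζ.ne_zero (by omega)
  have hn0 : ((2 * k + 1 : ℕ) : ℂ) ≠ 0 := by exact_mod_cast Nat.succ_ne_zero (2 * k)
  let A : Matrix (Fin (2 * k + 1)) (Fin (2 * k + 1)) ℂ := of fun i j =>
    if i = j then (1 / 2 : ℂ) else 1 / (1 - ζ ^ ((i : ℤ) - (j : ℤ)))
  let V : Matrix (Fin (2 * k + 1)) (Fin (2 * k + 1)) ℂ := of fun i r => (ζ ^ (i : ℤ)) ^ (r : ℕ)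
  let U : Matrix (Fin (2 * k + 1)) (Fin (2 * k + 1)) ℂ := of fun r i =>
    ((2 * k + 1 : ℕ) : ℂ)⁻¹ * (ζ ^ (-(i : ℤ))) ^ (r : ℕ)
  let d : Fin (2 * k + 1) → ℂ := fun r => (((2 * k + 1 : ℕ) : ℂ) - 2 * (r : ℕ)) / 2
  have hd (r) : d r ≠ 0 := by
    refine div_ne_zero (sub_ne_zero.2 ?_) two_ne_zero
    norm_cast
    omega
  have hVcU (i j r : Fin (2 * k + 1)) (c : ℂ) : V i r * c * U r j =
      ((2 * k + 1 : ℕ) : ℂ)⁻¹ * (ζ ^ ((i : ℤ) - (j : ℤ))) ^ (r : ℕ) * c := by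
    simp only [V, U, of_apply, sub_eq_add_neg, zpow_add₀ hζ0, mul_pow]
    ring
  have hVU (i j r : Fin (2 * k + 1)) : V i r * U r j =
      ((2 * k + 1 : ℕ) : ℂ)⁻¹ * (ζ ^ ((i : ℤ) - (j : ℤ))) ^ (r : ℕ) := by
    simpa using hVcU i j r 1
  have hVU1 : V * U = 1 := by
    ext i j
    simp only [mul_apply, hVU, ← mul_sum, zpow_geom_sum_eq_ite hζ, one_apply]
    split_ifs
    · exact inv_mul_cancel₀ hn0
    · exact mul_zero _
  have hUV1 : U * V = 1 := mul_eq_one_comm.1 hVU1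
  have hA : A = V * diagonal d * U := by
    ext i j
    have := sum_fin_mul_zpow hζ i j
    rw [mul_apply]
    simp only [mul_diagonal, hVcU]
    have he : ∀ r : Fin (2 * k + 1), ((2 * k + 1 : ℕ) : ℂ)⁻¹ *
        (ζ ^ ((i : ℤ) - (j : ℤ))) ^ (r : ℕ) * d r = (((2 * k + 1 : ℕ) : ℂ)⁻¹ / 2) *
        ((((2 * k + 1 : ℕ) : ℂ) - 2 * (r : ℕ)) * (ζ ^ ((i : ℤ) - (j : ℤ))) ^ (r : ℕ)) :=
      fun r => by simp only [d]; ring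
    simp only [he, ← mul_sum, this, A, of_apply]
    field_simp
  have hAB : A * (V * diagonal d⁻¹ * U) = 1 := by
    have hdd : diagonal d * diagonal d⁻¹ = 1 := by
      rw [diagonal_mul_diagonal, ← diagonal_one]
      exact congrArg diagonal (funext fun r => mul_inv_cancel₀ (hd r))
    calc A * (V * diagonal d⁻¹ * U) = V * diagonal d * (U * V) * diagonal d⁻¹ * U := by
          rw [hA]; simp only [Matrix.mul_assoc]
      _ = V * (diagonal d * diagonal d⁻¹) * U := by
          rw [hUV1, Matrix.mul_one]; simp only [Matrix.mul_assoc]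
      _ = 1 := by rw [hdd, Matrix.mul_one, hVU1]
  have hdet : A.det = ∏ r, d r := by
    rw [hA, det_mul, det_mul, det_diagonal, mul_right_comm, ← det_mul, hVU1, det_one, one_mul]
  have hadj : A.adjugate = A.det • (V * diagonal d⁻¹ * U) := by
    rw [← Matrix.mul_one A.adjugate, ← hAB, ← Matrix.mul_assoc, adjugate_mul, smul_mul_assoc,
      Matrix.one_mul]
  have hB : (V * diagonal d⁻¹ * U) 0 0 = 2 / ((2 * k + 1 : ℕ) : ℂ) ^ 2 := by
    rw [mul_apply]
    simp only [mul_diagonal, hVcU, sub_self, zpow_zero, one_pow, mul_one,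
      ← mul_sum]
    have hs : ∑ r, d⁻¹ r = 2 / ((2 * k + 1 : ℕ) : ℂ) := by
      simp only [Pi.inv_apply, d, inv_div]
      rw [Fin.sum_univ_eq_sum_range (fun r => 2 / (((2 * k + 1 : ℕ) : ℂ) - 2 * r)) (2 * k + 1),
        sum_range_succ']
      have he : ∑ r ∈ range (2 * k), 2 / (((2 * k + 1 : ℕ) : ℂ) - 2 * (r + 1 : ℕ)) =
          2 * ∑ r ∈ range (2 * k), ((2 * k : ℂ) - 1 - 2 * r)⁻¹ := by
        rw [mul_sum]
        refine sum_congr rfl fun r _ => ?_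
        rw [div_eq_mul_inv]
        push_cast
        ring_nf
      rw [he, sum_range_odd_inv_eq_zero]
      simp
    rw [hs]
    field_simp
  have hprod : ∏ r, d r = ((2 * k + 1 : ℕ) : ℂ) * ((-1) ^ k * ((2 * k - 1)‼ : ℂ) ^ 2) /
      2 ^ (2 * k + 1) := by
    simp only [d, prod_div_distrib, prod_const, card_univ, Fintype.card_fin]
    rw [Fin.prod_univ_eq_prod_range (fun r => ((2 * k + 1 : ℕ) : ℂ) - 2 * r) (2 * k + 1),
      prod_range_succ', ← prod_range_odd_eq]
    have he : ∏ r ∈ range (2 * k), (((2 * k + 1 : ℕ) : ℂ) - 2 * (r + 1 : ℕ)) =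
        ∏ r ∈ range (2 * k), ((2 * k : ℂ) - 1 - 2 * r) :=
      prod_congr rfl fun r _ => by push_cast; ring
    rw [he]
    simp [mul_comm]
  have hminor : A.adjugate 0 0 = Matrix.det (Matrix.of fun i j : Fin (2 * k) =>
      if i = j then (1 / 2 : ℂ) else 1 / (1 - ζ ^ ((i : ℤ) - (j : ℤ)))) := by
    rw [adjugate_fin_succ_eq_det_submatrix]
    simp only [Fin.val_zero, add_zero, pow_zero, one_mul]
    congr 1
    ext i j
    simp [A]
  change Matrix.det (Matrix.of fun i j : Fin (2 * k) =>
      if i = j then (1 / 2 : ℂ) else 1 / (1 - ζ ^ ((i : ℤ) - (j : ℤ)))) = _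
  rw [← hminor, hadj, Matrix.smul_apply, hB, hdet, hprod, smul_eq_mul,
    show (2 * k + 1 - 1) / 2 = k by omega, show 2 * k + 1 - 2 = 2 * k - 1 by omega,
    show 2 * k + 1 - 1 = 2 * k by omega]
  field_simp
  ring
end

section
/- Let n > 1 be an odd integer, and let ζ ∈ ℂ be a primitive n-th root of unity. For j, k = 1, ..., n-1 define c_{jk} = 1/(1 - ζ^{j-k}) if j ≠ k, and c_{jj} = 0. Then det[c_{jk} + δ_{jk}]_{1 ≤ j,k ≤ n-1} = (-1)^{(n+1)/2} (n+1) ((n-1)!!)^2 / (n(n-1) 2^{n-1}). -/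
open scoped Nat

open Matrix in
theorem Matrix.adjugate_conj_of_mul_eq_one {ι R : Type*} [Fintype ι] [DecidableEq ι] [CommRing R]
    {F P : Matrix ι ι R} (h : F * P = 1) (M : Matrix ι ι R) :
    (F * M * P).adjugate = F * M.adjugate * P := by
  have h' : P * F = 1 := mul_eq_one_comm.mp h
  have hP : P.adjugate = P.det • F := by
    calc P.adjugate = P.adjugate * (P * F) := by rw [h', mul_one]
      _ = P.det • F := by rw [← mul_assoc, adjugate_mul, smul_mul_assoc, one_mul]
  have hF : F.adjugate = F.det • P := by
    calc F.adjugate = F.adjugate * (F * P) := by rw [h, mul_one]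
      _ = F.det • P := by rw [← mul_assoc, adjugate_mul, smul_mul_assoc, one_mul]
  have hdet : F.det * P.det = 1 := by rw [← det_mul, h, det_one]
  rw [adjugate_mul_distrib, adjugate_mul_distrib, hP, hF]
  simp only [smul_mul_assoc, mul_smul_comm, smul_smul, hdet, one_smul, mul_assoc]

theorem sum_range_mul_pow_mul_sub_one {R : Type*} [CommRing R] (x : R) (n : ℕ) :
    (∑ r ∈ Finset.range n, (r : R) * x ^ r) * (x - 1) =
      n * x ^ n - x * ∑ r ∈ Finset.range n, x ^ r := by
  induction n with
  | zero => simp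
  | succ n ih =>
    rw [Finset.sum_range_succ, Finset.sum_range_succ, add_mul, ih]
    push_cast
    ring

theorem sum_range_pow_eq_zero_of_pow_eq_one {K : Type*} [Field K] {x : K} {n : ℕ}
    (hx : x ^ n = 1) (h1 : x ≠ 1) : ∑ r ∈ Finset.range n, x ^ r = 0 := by
  rw [geom_sum_eq h1, hx, sub_self, zero_div]

theorem sum_range_sub_mul_pow_of_pow_eq_one {K : Type*} [Field K] {x : K} {n : ℕ}
    (hx : x ^ n = 1) (h1 : x ≠ 1) (c : K) :
    ∑ r ∈ Finset.range n, (c - r) * x ^ r = n * (1 / (1 - x)) := by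
  have h := sum_range_mul_pow_mul_sub_one x n
  have h0 := sum_range_pow_eq_zero_of_pow_eq_one hx h1
  have hne : 1 - x ≠ 0 := sub_ne_zero.mpr h1.symm
  rw [h0, hx] at h
  simp only [sub_mul, Finset.sum_sub_distrib, ← Finset.mul_sum, h0]
  field_simp
  linear_combination h

theorem sum_range_sub_natCast (m : ℕ) :
    ∑ r ∈ Finset.range (2 * m + 1), ((m : ℂ) + 1 - r) = ((2 * m + 1 : ℕ) : ℂ) := by
  have h : ∀ k : ℕ, ∑ r ∈ Finset.range k, ((m : ℂ) + 1 - r) = k * (m + 1) - k * (k - 1) / 2 := by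
    intro k
    induction k with
    | zero => simp
    | succ k ih => rw [Finset.sum_range_succ, ih]; push_cast; ring
  rw [h]
  push_cast
  ring

theorem prod_range_ite_sub_natCast (t : ℕ) :
    ∏ r ∈ Finset.range (2 * (t + 1) + 1),
      (if r = t + 2 then (1 : ℂ) else ((t + 1 : ℕ) : ℂ) + 1 - r) =
      (-1) ^ t * (t + 2)! * t ! := by
  rw [show 2 * (t + 1) + 1 = (t + 2 + 1) + t by ring, Finset.prod_range_add,
    Finset.prod_range_succ, if_pos rfl, mul_one]
  have h1 : ∏ r ∈ Finset.range (t + 2),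
      (if r = t + 2 then (1 : ℂ) else ((t + 1 : ℕ) : ℂ) + 1 - r) = (t + 2)! := by
    rw [← Finset.prod_range_add_one_eq_factorial, ← Finset.prod_range_reflect, Nat.cast_prod]
    refine Finset.prod_congr rfl fun r hr => ?_
    have hr := Finset.mem_range.mp hr
    rw [if_neg (by omega), Nat.cast_sub (by omega), Nat.cast_sub (by omega)]
    push_cast
    ring
  have h2 : ∏ r ∈ Finset.range t,
      (if t + 2 + 1 + r = t + 2 then (1 : ℂ)
        else ((t + 1 : ℕ) : ℂ) + 1 - ((t + 2 + 1 + r : ℕ) : ℂ)) = (-1) ^ t * t ! := by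
    rw [← Finset.prod_range_add_one_eq_factorial, Nat.cast_prod, ← Finset.card_range t,
      ← Finset.prod_const, Finset.card_range, ← Finset.prod_mul_distrib]
    refine Finset.prod_congr rfl fun r _ => ?_
    rw [if_neg (by omega)]
    push_cast
    ring
  rw [h1, h2]
  ring

theorem sum_prod_erase_sub_natCast (t : ℕ) :
    ∑ i : Fin (2 * (t + 1) + 1), ∏ j ∈ Finset.univ.erase i, (((t + 1 : ℕ) : ℂ) + 1 - (j : ℕ)) =
      (-1) ^ t * (t + 2)! * t ! := by
  let a : Fin (2 * (t + 1) + 1) := ⟨t + 2, by omega⟩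
  rw [Finset.sum_eq_single a, ← prod_range_ite_sub_natCast, ← Fin.prod_univ_eq_prod_range
    (fun r => if r = t + 2 then (1 : ℂ) else ((t + 1 : ℕ) : ℂ) + 1 - r),
    ← Finset.prod_erase (a := a) Finset.univ (by exact if_pos rfl)]
  · refine Finset.prod_congr rfl fun j hj => (if_neg fun h => ?_).symm
    exact Finset.ne_of_mem_erase hj (Fin.ext h)
  · intro b _ hb
    refine Finset.prod_eq_zero (i := a) (by simp [hb.symm]) ?_
    simp only [a]
    push_cast
    ring
  · simp

theorem IsPrimitiveRoot.zpow_pow_eq_one {G : Type*} [Field G] {ζ : G} {n : ℕ}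
    (hζ : IsPrimitiveRoot ζ n) (d : ℤ) : (ζ ^ d) ^ n = 1 := by
  rw [← zpow_natCast, ← zpow_mul, mul_comm, zpow_mul, zpow_natCast, hζ.pow_eq_one, one_zpow]

theorem IsPrimitiveRoot.zpow_sub_ne_one {G : Type*} [Field G] {ζ : G} {n i j : ℕ}
    (hζ : IsPrimitiveRoot ζ n) (hi : i < n) (hj : j < n) (hij : i ≠ j) :
    ζ ^ ((i : ℤ) - (j : ℤ)) ≠ 1 := by
  rw [Ne, hζ.zpow_eq_one_iff_dvd]
  intro hd
  have := Int.eq_zero_of_abs_lt_dvd hd (by rw [abs_lt]; omega)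
  omega

open Matrix in
/-- The principal minor of a circulant matrix with eigenvalues `v r`, obtained by deleting the first
row and column. -/
theorem IsPrimitiveRoot.det_submatrix_succ {k : ℕ} {ζ : ℂ} (hζ : IsPrimitiveRoot ζ (k + 1))
    (v : ℕ → ℂ) :
    (Matrix.of fun i j : Fin k => ((k + 1 : ℕ) : ℂ)⁻¹ *
      ∑ r ∈ Finset.range (k + 1), v r * (ζ ^ ((i : ℤ) - (j : ℤ))) ^ r).det =
    ((k + 1 : ℕ) : ℂ)⁻¹ * ∑ i : Fin (k + 1), ∏ j ∈ Finset.univ.erase i, v j := by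
  have hζ0 : ζ ≠ 0 := hζ.ne_zero k.succ_ne_zero
  have hk : ((k + 1 : ℕ) : ℂ) ≠ 0 := Nat.cast_ne_zero.mpr k.succ_ne_zero
  let F : Matrix (Fin (k + 1)) (Fin (k + 1)) ℂ := of fun i r => (ζ ^ (i : ℕ)) ^ (r : ℕ)
  let P : Matrix (Fin (k + 1)) (Fin (k + 1)) ℂ :=
    of fun r j => ((k + 1 : ℕ) : ℂ)⁻¹ * ((ζ ^ (j : ℕ))⁻¹) ^ (r : ℕ)
  have hFDP (w : ℕ → ℂ) (i j : Fin (k + 1)) :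
      (F * diagonal (fun r : Fin (k + 1) => w r) * P) i j = ((k + 1 : ℕ) : ℂ)⁻¹ *
        ∑ r ∈ Finset.range (k + 1), w r * (ζ ^ ((i : ℤ) - (j : ℤ))) ^ r := by
    rw [mul_apply, ← Fin.sum_univ_eq_sum_range
      (fun r => w r * (ζ ^ ((i : ℤ) - (j : ℤ))) ^ r), Finset.mul_sum]
    refine Finset.sum_congr rfl fun r _ => ?_
    rw [mul_diagonal, zpow_sub₀ hζ0, zpow_natCast, zpow_natCast, div_eq_mul_inv, mul_pow]
    simp only [F, P, of_apply]
    ring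
  have hFP : F * P = 1 := by
    ext i j
    have h := hFDP 1 i j
    simp only [Pi.one_apply, diagonal_one, mul_one, one_mul] at h
    rw [h]
    by_cases hij : i = j
    · subst hij
      simpa using inv_mul_cancel₀ hk
    · rw [one_apply_ne hij, sum_range_pow_eq_zero_of_pow_eq_one, mul_zero]
      · exact hζ.zpow_pow_eq_one _
      · exact hζ.zpow_sub_ne_one (by omega) (by omega) (Fin.val_ne_of_ne hij)
  have hadj := congrFun₂ (adjugate_conj_of_mul_eq_one hFP (diagonal fun r : Fin (k + 1) => v r)) 0 0
  rw [adjugate_fin_succ_eq_det_submatrix, adjugate_diagonal, mul_apply] at hadj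
  simp only [mul_diagonal, F, P, of_apply, Fin.val_zero, pow_zero, one_pow, inv_one, one_mul,
    mul_one, add_zero] at hadj
  rw [← Finset.sum_mul, mul_comm] at hadj
  rw [← hadj]
  congr 1
  ext i j
  rw [submatrix_apply, of_apply]
  refine Eq.trans ?_ (hFDP v _ _).symm
  simp

theorem stmt_11 (n : ℕ) (hn : 1 < n) (hodd : Odd n) (ζ : ℂ)
    (hζ : IsPrimitiveRoot ζ n) :
    Matrix.det (Matrix.of fun j k : Fin (n - 1) =>
      (if j = k then (0 : ℂ) else 1 / (1 - ζ ^ ((j : ℤ) - (k : ℤ)))) +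
        (if j = k then 1 else 0)) =
    (-1) ^ ((n + 1) / 2) * (n + 1) * ((n - 1)‼ : ℂ) ^ 2 /
      (n * (n - 1) * 2 ^ (n - 1)) := by
  obtain ⟨m, rfl⟩ := hodd
  obtain ⟨t, rfl⟩ : ∃ t, m = t + 1 := ⟨m - 1, by omega⟩
  have hN : ((2 * (t + 1) + 1 : ℕ) : ℂ) ≠ 0 := Nat.cast_ne_zero.mpr (by omega)
  have hdet := hζ.det_submatrix_succ fun r => ((t + 1 : ℕ) : ℂ) + 1 - r
  rw [sum_prod_erase_sub_natCast] at hdet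
  have hentries : (Matrix.of fun j k : Fin (2 * (t + 1) + 1 - 1) =>
      (if j = k then (0 : ℂ) else 1 / (1 - ζ ^ ((j : ℤ) - (k : ℤ)))) +
        (if j = k then 1 else 0)) =
      Matrix.of fun i j : Fin (2 * (t + 1)) => ((2 * (t + 1) + 1 : ℕ) : ℂ)⁻¹ *
        ∑ r ∈ Finset.range (2 * (t + 1) + 1),
          (((t + 1 : ℕ) : ℂ) + 1 - r) * (ζ ^ ((i : ℤ) - (j : ℤ))) ^ r := by
    ext i j
    simp only [Matrix.of_apply]
    by_cases hij : i = j
    · subst hij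
      simp only [if_true, sub_self, zpow_zero, one_pow, mul_one, zero_add]
      rw [sum_range_sub_natCast, inv_mul_cancel₀ hN]
    · rw [if_neg hij, if_neg hij, add_zero, sum_range_sub_mul_pow_of_pow_eq_one,
        inv_mul_cancel_left₀ hN]
      · exact hζ.zpow_pow_eq_one _
      · exact hζ.zpow_sub_ne_one (by omega) (by omega) (Fin.val_ne_of_ne hij)
  rw [hentries]
  refine hdet.trans ?_
  have ht : ((t : ℂ) + 1) ≠ 0 := Nat.cast_add_one_ne_zero t
  rw [show (2 * (t + 1) + 1 + 1) / 2 = t + 2 by omega, Nat.add_sub_cancel,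
    Nat.doubleFactorial_two_mul, Nat.factorial_succ (t + 1), Nat.factorial_succ t]
  push_cast at hN ⊢
  rw [add_sub_cancel_right]
  field_simp
  ring
end

section
/- Let n > 1 be an odd integer, and let ζ ∈ ℂ be a primitive n-th root of unity. For j, k = 1, ..., n define a_{jk} = (1 + ζ^{j-k})/(1 - ζ^{j-k}) if j ≠ k, and a_{jj} = 0. Then det(x I_n - [a_{jk}]_{1 ≤ j,k ≤ n}) = x ∏_{s=1}^{n-1} (x - (n - 2s)) as polynomials in x; that is, the eigenvalues of the n × n matrix [a_{jk}]_{1 ≤ j,k ≤ n} are n - 2s for s = 1, ..., n-1, together with 0. -/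
theorem IsPrimitiveRoot.sum_fin_pow_pow_eq_zero {n : ℕ} {ζ : ℂ} (hζ : IsPrimitiveRoot ζ n)
    {s : ℕ} (hs : s ≠ 0) (hsn : s < n) : ∑ k : Fin n, (ζ ^ (k : ℕ)) ^ s = 0 := by
  have hne : ζ ^ s ≠ 1 := hζ.pow_ne_one_of_pos_of_lt hs hsn
  have h := geom_sum_mul (ζ ^ s) n
  rw [← pow_mul, mul_comm s n, pow_mul, hζ.pow_eq_one, one_pow, sub_self] at h
  rw [Fin.sum_univ_eq_sum_range (fun k => (ζ ^ k) ^ s)]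
  simpa [← pow_mul, mul_comm, sub_ne_zero.mpr hne] using h

theorem IsPrimitiveRoot.pow_fin_injective {n : ℕ} {ζ : ℂ} (hζ : IsPrimitiveRoot ζ n) :
    Function.Injective fun k : Fin n => ζ ^ (k : ℕ) :=
  fun a b h => Fin.ext (hζ.pow_inj a.2 b.2 h)

theorem IsPrimitiveRoot.pow_fin_add {n : ℕ} {ζ : ℂ} (hζ : IsPrimitiveRoot ζ n) (a b : Fin n) :
    ζ ^ ((a + b : Fin n) : ℕ) = ζ ^ (a : ℕ) * ζ ^ (b : ℕ) := by
  rw [Fin.val_add, ← pow_add, ← pow_eq_pow_mod _ hζ.pow_eq_one]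

/-- The kernel `(z + w) / (z - w)` on the `n`-th roots of unity, with value `0` on the diagonal
(which division by zero provides). -/
noncomputable def rootKernel {n : ℕ} (ζ : ℂ) (j k : Fin n) : ℂ :=
  (ζ ^ (k : ℕ) + ζ ^ (j : ℕ)) / (ζ ^ (k : ℕ) - ζ ^ (j : ℕ))

theorem sum_rootKernel {n : ℕ} {ζ : ℂ} (hζ : IsPrimitiveRoot ζ n) (j : Fin n) :
    ∑ k, rootKernel ζ j k = 0 := by
  have : NeZero n := ⟨by have := j.2; omega⟩
  have h : ∑ k, rootKernel ζ j k = ∑ k, -rootKernel ζ j k := by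
    refine Fintype.sum_equiv (Equiv.subLeft (j + j)) _ _ fun k => ?_
    have hk : ζ ^ ((j + j - k : Fin n) : ℕ) * ζ ^ (k : ℕ) = ζ ^ (j : ℕ) * ζ ^ (j : ℕ) := by
      rw [← hζ.pow_fin_add, ← hζ.pow_fin_add, sub_add_cancel]
    have h0 : ∀ i : Fin n, ζ ^ (i : ℕ) ≠ 0 := fun i => pow_ne_zero _ (hζ.ne_zero NeZero.out)
    simp only [rootKernel, Equiv.subLeft_apply]
    rw [eq_div_of_mul_eq (h0 k) hk]
    have hk0 := h0 k
    have hj0 := h0 j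
    generalize ζ ^ (k : ℕ) = z at *
    generalize ζ ^ (j : ℕ) = w at *
    rcases eq_or_ne z w with rfl | hzw
    · simp
    · have h1 : z - w ≠ 0 := sub_ne_zero.mpr hzw
      have h2 : w * w / z - w ≠ 0 := by
        have : w * w / z - w = -(w * (z - w) / z) := by field_simp; ring
        rw [this]
        exact neg_ne_zero.mpr (div_ne_zero (mul_ne_zero hj0 h1) hk0)
      rw [← neg_div, div_eq_div_iff h1 h2]
      field_simp
      ring
  rw [Finset.sum_neg_distrib] at h
  exact self_eq_neg.mp h

theorem sum_rootKernel_mul_pow_succ {n : ℕ} {ζ : ℂ} (hζ : IsPrimitiveRoot ζ n) (j : Fin n)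
    (s : ℕ) :
    ∑ k : Fin n, rootKernel ζ j k * (ζ ^ (k : ℕ)) ^ (s + 1) =
      ζ ^ (j : ℕ) * ∑ k : Fin n, rootKernel ζ j k * (ζ ^ (k : ℕ)) ^ s +
        ∑ k : Fin n, (ζ ^ (k : ℕ)) ^ (s + 1) + ζ ^ (j : ℕ) * ∑ k : Fin n, (ζ ^ (k : ℕ)) ^ s -
        2 * (ζ ^ (j : ℕ)) ^ (s + 1) := by
  have hj : 2 * (ζ ^ (j : ℕ)) ^ (s + 1) =
      ∑ k : Fin n, if k = j then 2 * (ζ ^ (j : ℕ)) ^ (s + 1) else 0 := by simp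
  rw [hj, Finset.mul_sum, Finset.mul_sum, ← Finset.sum_add_distrib, ← Finset.sum_add_distrib,
    ← Finset.sum_sub_distrib]
  refine Finset.sum_congr rfl fun k _ => ?_
  rcases eq_or_ne k j with rfl | hkj
  · simp [rootKernel]
    ring
  · have hne : ζ ^ (k : ℕ) - ζ ^ (j : ℕ) ≠ 0 :=
      sub_ne_zero.mpr fun h => hkj (hζ.pow_fin_injective h)
    simp only [rootKernel, hkj, if_false]
    field_simp
    ring

theorem sum_rootKernel_mul_pow {n : ℕ} {ζ : ℂ} (hζ : IsPrimitiveRoot ζ n) (j : Fin n)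
    {s : ℕ} (hs : s + 1 < n) :
    ∑ k : Fin n, rootKernel ζ j k * (ζ ^ (k : ℕ)) ^ (s + 1) =
      (ζ ^ (j : ℕ)) ^ (s + 1) * (n - 2 * (s + 1 : ℕ)) := by
  induction s with
  | zero =>
    rw [sum_rootKernel_mul_pow_succ hζ, hζ.sum_fin_pow_pow_eq_zero (by omega) hs]
    simp [sum_rootKernel hζ]
    ring
  | succ s ih =>
    rw [sum_rootKernel_mul_pow_succ hζ, hζ.sum_fin_pow_pow_eq_zero (by omega) hs,
      hζ.sum_fin_pow_pow_eq_zero (by omega) (by omega), ih (by omega)]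
    push_cast
    ring

theorem one_add_zpow_div_one_sub_zpow {n : ℕ} {ζ : ℂ} (hζ : ζ ≠ 0) (j k : Fin n) :
    (if j = k then (0 : ℂ) else
      (1 + ζ ^ ((j : ℤ) - (k : ℤ))) / (1 - ζ ^ ((j : ℤ) - (k : ℤ)))) = rootKernel ζ j k := by
  split_ifs with h
  · simp [h, rootKernel]
  · have hk : ζ ^ (k : ℕ) ≠ 0 := pow_ne_zero _ hζ
    rw [rootKernel, zpow_sub₀ hζ, zpow_natCast, zpow_natCast, ← mul_div_mul_right _ _ hk]
    congr 1 <;> field_simp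

theorem stmt_13 (n : ℕ) (hn : 1 < n) (hodd : Odd n) (ζ : ℂ)
    (hζ : IsPrimitiveRoot ζ n) (x : ℂ) :
    Matrix.det (x • (1 : Matrix (Fin n) (Fin n) ℂ) -
      Matrix.of fun j k : Fin n =>
        if j = k then (0 : ℂ) else
          (1 + ζ ^ ((j : ℤ) - (k : ℤ))) / (1 - ζ ^ ((j : ℤ) - (k : ℤ)))) =
    x * ∏ s ∈ Finset.Icc 1 (n - 1), (x - ((n : ℂ) - 2 * s)) := by
  simp only [one_add_zpow_div_one_sub_zpow (hζ.ne_zero (by omega))]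
  set V := Matrix.vandermonde fun k : Fin n => ζ ^ (k : ℕ) with hV
  let μ : ℕ → ℂ := fun s => if s = 0 then 0 else n - 2 * s
  have hVdet : V.det ≠ 0 := Matrix.det_vandermonde_ne_zero_iff.mpr hζ.pow_fin_injective
  have hmul : (x • (1 : Matrix (Fin n) (Fin n) ℂ) - Matrix.of fun j k => rootKernel ζ j k) * V =
      V * Matrix.diagonal fun s : Fin n => x - μ s := by
    ext j s
    rw [sub_mul, smul_mul_assoc, one_mul, Matrix.mul_diagonal, Matrix.sub_apply,
      Matrix.smul_apply, Matrix.mul_apply]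
    simp only [hV, Matrix.of_apply, Matrix.vandermonde_apply, smul_eq_mul]
    obtain ⟨s, hs⟩ := s
    cases s with
    | zero => simp [μ, sum_rootKernel hζ]
    | succ s =>
      rw [sum_rootKernel_mul_pow hζ j hs]
      simp only [μ, Nat.succ_ne_zero, if_false]
      ring
  have hdet := congrArg Matrix.det hmul
  rw [Matrix.det_mul, Matrix.det_mul, mul_comm, Matrix.det_diagonal] at hdet
  rw [mul_left_cancel₀ hVdet hdet, Fin.prod_univ_eq_prod_range (fun s => x - μ s)]
  obtain ⟨m, rfl⟩ : ∃ m, n = m + 1 := ⟨n - 1, by omega⟩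
  rw [Finset.prod_range_succ', mul_comm, Nat.add_sub_cancel, Finset.range_eq_Ico,
    Finset.prod_Ico_add' (fun s => x - μ s) 0 m 1, zero_add, Finset.Ico_add_one_right_eq_Icc]
  congr 1
  · simp [μ]
  · refine Finset.prod_congr rfl fun s hs => ?_
    have : s ≠ 0 := by have := (Finset.mem_Icc.mp hs).1; omega
    simp [μ, this]
end

section
/- Let n > 1 be an odd integer, let k ∈ {1, ..., n}, let s ∈ {0, 1, ..., n-1}, and let ζ ∈ ℂ be a primitive n-th root of unity. Then 1 + ∑_{j=1, j≠k}^{n} ((1 + ζ^{j-k})/(1 - ζ^{j-k})) ζ^{s(k-j)} equals n + 1 - 2s if 0 < s < n, and equals 1 if s = 0. -/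
open Polynomial in
theorem IsPrimitiveRoot.sum_nthRootsFinset_inv_pow {K : Type*} [Field K] {n : ℕ} {ζ : K}
    (hζ : IsPrimitiveRoot ζ n) {m : ℕ} (hm : m ≠ 0) (hmn : m < n) :
    ∑ w ∈ nthRootsFinset n (1 : K), w⁻¹ ^ m = 0 := by
  have hn : 0 < n := by omega
  have hζ0 : ζ ≠ 0 := hζ.ne_zero (by omega)
  have hshift : ∑ w ∈ nthRootsFinset n (1 : K), w⁻¹ ^ m =
      ∑ w ∈ nthRootsFinset n (1 : K), ζ⁻¹ ^ m * w⁻¹ ^ m := by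
    refine Finset.sum_nbij' (fun w => ζ⁻¹ * w) (fun w => ζ * w) ?_ ?_ ?_ ?_ ?_
    · intro w hw
      rw [Polynomial.mem_nthRootsFinset hn] at hw ⊢
      rw [mul_pow, inv_pow, hζ.pow_eq_one, hw, inv_one, one_mul]
    · intro w hw
      rw [Polynomial.mem_nthRootsFinset hn] at hw ⊢
      rw [mul_pow, hζ.pow_eq_one, hw, one_mul]
    · intro w _
      exact mul_inv_cancel_left₀ hζ0 w
    · intro w _
      exact inv_mul_cancel_left₀ hζ0 w
    · intro w _
      rw [← mul_pow, mul_inv, inv_inv, inv_mul_cancel_left₀ hζ0]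
  rw [← Finset.mul_sum] at hshift
  have hne : ζ⁻¹ ^ m ≠ 1 := hζ.inv.pow_ne_one_of_pos_of_lt hm hmn
  by_contra hS
  exact hne (mul_right_cancel₀ hS (by rw [one_mul, ← hshift]))

open Polynomial in
theorem IsPrimitiveRoot.image_zpow_sub_Icc {K : Type*} [Field K] [DecidableEq K] {n : ℕ} {ζ : K}
    (hζ : IsPrimitiveRoot ζ n) (hn : 0 < n) (k : ℕ) :
    Set.InjOn (fun j : ℕ => ζ ^ ((j : ℤ) - (k : ℤ))) (Finset.Icc 1 n) ∧
      (Finset.Icc 1 n).image (fun j : ℕ => ζ ^ ((j : ℤ) - (k : ℤ))) =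
        nthRootsFinset n (1 : K) := by
  have hζ0 : ζ ≠ 0 := hζ.ne_zero (by omega)
  have hinj : Set.InjOn (fun j : ℕ => ζ ^ ((j : ℤ) - (k : ℤ))) (Finset.Icc 1 n) := by
    intro a ha b hb hab
    simp only [Finset.coe_Icc, Set.mem_Icc] at ha hb
    have h1 : ζ ^ ((a : ℤ) - b) = 1 := by
      have : (a : ℤ) - b = (a - k) - (b - k) := by ring
      rw [this, zpow_sub₀ hζ0]
      exact (div_eq_one_iff_eq (zpow_ne_zero _ hζ0)).2 hab
    rw [hζ.zpow_eq_one_iff_dvd] at h1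
    have := Int.eq_zero_of_abs_lt_dvd h1 (by rw [abs_lt]; omega)
    omega
  refine ⟨hinj, Finset.eq_of_subset_of_card_le ?_ ?_⟩
  · intro w hw
    obtain ⟨j, -, rfl⟩ := Finset.mem_image.1 hw
    rw [Polynomial.mem_nthRootsFinset hn, ← zpow_natCast, ← zpow_mul, mul_comm, zpow_mul, zpow_natCast,
      hζ.pow_eq_one, one_zpow]
  · rw [Finset.card_image_of_injOn hinj, hζ.card_nthRootsFinset, Nat.card_Icc]
    omega

open Polynomial in
theorem IsPrimitiveRoot.sum_erase_one_cayley_mul_inv_pow {K : Type*} [Field K] [CharZero K]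
    [DecidableEq K] {n : ℕ} {ζ : K} (hζ : IsPrimitiveRoot ζ n) {s : ℕ} (hs : s < n) :
    ∑ w ∈ (nthRootsFinset n (1 : K)).erase 1, (1 + w) / (1 - w) * w⁻¹ ^ s =
      if s = 0 then 0 else (n : K) - 2 * s := by
  have hn : 0 < n := by omega
  have hone : (1 : K) ∈ nthRootsFinset n (1 : K) := by simp [Polynomial.mem_nthRootsFinset hn]
  have hne : ∀ w ∈ (nthRootsFinset n (1 : K)).erase 1, w ≠ 0 ∧ 1 - w ≠ 0 := by
    intro w hw
    rw [Finset.mem_erase, Polynomial.mem_nthRootsFinset hn] at hw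
    refine ⟨?_, sub_ne_zero.2 (Ne.symm hw.1)⟩
    rintro rfl
    simp [hn.ne'] at hw
  have hpow : ∀ m : ℕ, m ≠ 0 → m < n →
      ∑ w ∈ (nthRootsFinset n (1 : K)).erase 1, w⁻¹ ^ m = -1 := by
    intro m hm hmn
    have h := Finset.add_sum_erase _ (fun w : K => w⁻¹ ^ m) hone
    rw [hζ.sum_nthRootsFinset_inv_pow hm hmn] at h
    simp only [inv_one, one_pow] at h
    linear_combination h
  have hstep : ∀ m : ℕ,
      ∑ w ∈ (nthRootsFinset n (1 : K)).erase 1, (1 + w) / (1 - w) * w⁻¹ ^ (m + 1) =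
        ∑ w ∈ (nthRootsFinset n (1 : K)).erase 1, (1 + w) / (1 - w) * w⁻¹ ^ m +
          ∑ w ∈ (nthRootsFinset n (1 : K)).erase 1, w⁻¹ ^ (m + 1) +
          ∑ w ∈ (nthRootsFinset n (1 : K)).erase 1, w⁻¹ ^ m := by
    intro m
    rw [← Finset.sum_add_distrib, ← Finset.sum_add_distrib]
    refine Finset.sum_congr rfl fun w hw => ?_
    obtain ⟨h0, h1⟩ := hne w hw
    rw [pow_succ]
    field_simp
    ring
  induction s with
  | zero =>
    have hneg : ∑ w ∈ (nthRootsFinset n (1 : K)).erase 1, (1 + w) / (1 - w) * w⁻¹ ^ 0 =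
        ∑ w ∈ (nthRootsFinset n (1 : K)).erase 1, -((1 + w) / (1 - w) * w⁻¹ ^ 0) := by
      have hmem : ∀ w ∈ (nthRootsFinset n (1 : K)).erase 1,
          w⁻¹ ∈ (nthRootsFinset n (1 : K)).erase 1 := by
        intro w hw
        rw [Finset.mem_erase, Polynomial.mem_nthRootsFinset hn] at hw ⊢
        simpa using hw
      refine Finset.sum_nbij' (fun w => w⁻¹) (fun w => w⁻¹) hmem hmem
        (fun w _ => inv_inv w) (fun w _ => inv_inv w) fun w hw => ?_
      obtain ⟨h0, h1⟩ := hne w hw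
      have h2 : 1 - w⁻¹ ≠ 0 := by
        rw [sub_ne_zero]
        intro h
        exact h1 (by rw [← inv_inv w, ← h, inv_one, sub_self])
      rw [pow_zero, pow_zero, mul_one, mul_one, ← neg_div, div_eq_div_iff h1 h2]
      field_simp
      ring
    rw [Finset.sum_neg_distrib] at hneg
    simpa using self_eq_neg.1 hneg
  | succ m ih =>
    rw [hstep, ih (by omega), hpow (m + 1) (by omega) hs]
    rcases Nat.eq_zero_or_pos m with rfl | hm
    · simp only [pow_zero, Finset.sum_const, Finset.card_erase_of_mem hone,
        hζ.card_nthRootsFinset, nsmul_eq_mul, Nat.cast_sub (show 1 ≤ n from hn)]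
      norm_num
      ring
    · rw [hpow m hm.ne' (by omega), if_neg hm.ne', if_neg (Nat.succ_ne_zero m)]
      push_cast
      ring

theorem stmt_16 (n : ℕ) (hn : 1 < n) (hodd : Odd n) (k : ℕ)
    (hk1 : 1 ≤ k) (hkn : k ≤ n) (s : ℕ) (hs : s < n) (ζ : ℂ)
    (hζ : IsPrimitiveRoot ζ n) :
    1 + ∑ j ∈ (Finset.Icc 1 n).erase k,
        (1 + ζ ^ ((j : ℤ) - (k : ℤ))) / (1 - ζ ^ ((j : ℤ) - (k : ℤ))) *
          ζ ^ ((s : ℤ) * ((k : ℤ) - (j : ℤ))) =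
      if s = 0 then 1 else (n : ℂ) + 1 - 2 * s := by
  obtain ⟨hinj, himage⟩ := hζ.image_zpow_sub_Icc (by omega) k
  have hk : k ∈ Finset.Icc 1 n := Finset.mem_Icc.2 ⟨hk1, hkn⟩
  have hsum : ∑ j ∈ (Finset.Icc 1 n).erase k,
      (1 + ζ ^ ((j : ℤ) - (k : ℤ))) / (1 - ζ ^ ((j : ℤ) - (k : ℤ))) *
        ζ ^ ((s : ℤ) * ((k : ℤ) - (j : ℤ))) =
      ∑ w ∈ (Polynomial.nthRootsFinset n (1 : ℂ)).erase 1,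
        (1 + w) / (1 - w) * w⁻¹ ^ s := by
    rw [Finset.sum_erase_eq_sub hk]
    rw [← himage, Finset.sum_erase_eq_sub (Finset.mem_image.2 ⟨k, hk, by simp⟩),
      Finset.sum_image hinj]
    congr 1
    · refine Finset.sum_congr rfl fun j _ => ?_
      rw [← zpow_neg, neg_sub, mul_comm (s : ℤ), zpow_mul, zpow_natCast]
    · simp
  rw [hsum, hζ.sum_erase_one_cayley_mul_inv_pow hs]
  split_ifs <;> ring
end
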